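/- arXiv:1903.04935 — 5 statements merged into one kernel-verified Lean document; each statement's English description precedes it below -/
import Mathlib

section
/- Let 0 < D₁ < 1 and 0 < D₂ ≤ 1, and let φ : ℝ³ → ℝ be twice continuously differentiable such that |∇φ(x) − ∇φ(y)| ≤ A·|x − y|^{1−D₁} and ‖∇²φ(x) − ∇²φ(y)‖ ≤ B·|x − y|^{D₂} for all x, y ∈ ℝ³, where A, B ≥ 0. Then for every r > 0 and every x ∈ ℝ³, ‖∇²φ(x)‖ ≤ r^{−D₁}·A + (1/(1 + D₂))·r^{D₂}·B. -/
open Real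

noncomputable section

/-- Interpolation inequality: if `φ : ℝ³ → ℝ` is `C²`, `∇φ` is uniformly Hölder
continuous of exponent `1 - D₁` with constant `A`, and `∇²φ` is uniformly Hölder continuous of
exponent `D₂` with constant `B`, then for every length scale `r > 0` and every `x`,
`‖∇²φ(x)‖ ≤ r^{-D₁} A + r^{D₂} B/(1 + D₂)`. -/
theorem stmt_1 (D₁ D₂ A B : ℝ) (hD₁ : 0 < D₁) (hD₁' : D₁ < 1) (hD₂ : 0 < D₂) (hD₂' : D₂ ≤ 1)
    (hA : 0 ≤ A) (hB : 0 ≤ B)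
    (φ : EuclideanSpace ℝ (Fin 3) → ℝ) (hφ : ContDiff ℝ 2 φ)
    (hgrad : ∀ x y : EuclideanSpace ℝ (Fin 3),
      ‖fderiv ℝ φ x - fderiv ℝ φ y‖ ≤ A * ‖x - y‖ ^ (1 - D₁))
    (hhess : ∀ x y : EuclideanSpace ℝ (Fin 3),
      ‖fderiv ℝ (fderiv ℝ φ) x - fderiv ℝ (fderiv ℝ φ) y‖ ≤ B * ‖x - y‖ ^ D₂)
    (r : ℝ) (hr : 0 < r) (x : EuclideanSpace ℝ (Fin 3)) :
    ‖fderiv ℝ (fderiv ℝ φ) x‖ ≤ r ^ (-D₁) * A + (1 / (1 + D₂)) * r ^ D₂ * B := by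
  have hrpos1 : 0 < r ^ (-D₁) := rpow_pos_of_pos hr _
  have hrpos2 : 0 < r ^ D₂ := rpow_pos_of_pos hr _
  have h1D : 0 < 1 + D₂ := by linarith
  have hG : ContDiff ℝ 1 (fderiv ℝ φ) := hφ.fderiv_right (by norm_num)
  have hGd : Differentiable ℝ (fderiv ℝ φ) := hG.differentiable (by norm_num)
  refine ContinuousLinearMap.opNorm_le_of_unit_norm (by positivity) ?_
  intro v hv
  have hder : ∀ t : ℝ, HasDerivAt
      (fun t : ℝ => fderiv ℝ φ (x + t • v) - fderiv ℝ φ x - t • (fderiv ℝ (fderiv ℝ φ) x v))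
      (fderiv ℝ (fderiv ℝ φ) (x + t • v) v - fderiv ℝ (fderiv ℝ φ) x v) t := by
    intro t
    have h1 : HasDerivAt (fun t : ℝ => x + t • v) v t := by
      simpa using ((hasDerivAt_id t).smul_const v).const_add x
    have h2 := (hGd (x + t • v)).hasFDerivAt.comp_hasDerivAt t h1
    have h3 : HasDerivAt (fun t : ℝ => t • (fderiv ℝ (fderiv ℝ φ) x v))
        (fderiv ℝ (fderiv ℝ φ) x v) t := by
      simpa using (hasDerivAt_id t).smul_const (fderiv ℝ (fderiv ℝ φ) x v)
    exact (h2.sub_const _).sub h3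
  have hderB : ∀ t : ℝ, HasDerivAt (fun t : ℝ => B * (t ^ (1 + D₂) / (1 + D₂)))
      (B * t ^ D₂) t := by
    intro t
    have h := ((Real.hasDerivAt_rpow_const (x := t) (p := 1 + D₂)
      (Or.inr (by linarith))).div_const (1 + D₂)).const_mul B
    have e : B * ((1 + D₂) * t ^ (1 + D₂ - 1) / (1 + D₂)) = B * t ^ D₂ := by
      rw [add_sub_cancel_left]
      field_simp
    rw [e] at h
    exact h
  have key := image_norm_le_of_norm_deriv_right_le_deriv_boundary (a := 0) (b := r)
    (fun t _ => (hder t).continuousAt.continuousWithinAt)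
    (fun t _ => (hder t).hasDerivWithinAt)
    (B := fun t : ℝ => B * (t ^ (1 + D₂) / (1 + D₂)))
    (B' := fun t => B * t ^ D₂)
    (by simp [Real.zero_rpow h1D.ne'])
    hderB
    (by
      intro t ht
      have h1 := (fderiv ℝ (fderiv ℝ φ) (x + t • v) - fderiv ℝ (fderiv ℝ φ) x).le_opNorm v
      have h2 := hhess (x + t • v) x
      rw [hv, mul_one] at h1
      have h3 : ‖x + t • v - x‖ = t := by
        rw [add_sub_cancel_left, norm_smul, hv, mul_one, Real.norm_of_nonneg ht.1]
      rw [h3] at h2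
      exact h1.trans h2)
    (Set.right_mem_Icc.2 hr.le)
  have h2 := hgrad (x + r • v) x
  have h3 : ‖x + r • v - x‖ = r := by
    rw [add_sub_cancel_left, norm_smul, hv, mul_one, Real.norm_of_nonneg hr.le]
  rw [h3] at h2
  have h4 : ‖r • (fderiv ℝ (fderiv ℝ φ) x v)‖ ≤ A * r ^ (1 - D₁)
      + B * (r ^ (1 + D₂) / (1 + D₂)) := by
    have := norm_sub_norm_le (r • (fderiv ℝ (fderiv ℝ φ) x v))
      (fderiv ℝ φ (x + r • v) - fderiv ℝ φ x)
    rw [norm_sub_rev (r • (fderiv ℝ (fderiv ℝ φ) x v))] at this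
    linarith
  rw [norm_smul, Real.norm_of_nonneg hr.le, sub_eq_add_neg, Real.rpow_add hr,
    Real.rpow_add hr, Real.rpow_one] at h4
  refine le_of_mul_le_mul_left (h4.trans (le_of_eq ?_)) hr
  ring
end
end

section
/- (Interpolation with exponential rates, whole-space version of Lemma 7.1.) Let 0 < D₁ < 1, 0 < D₂ ≤ 1 and Λ₀ > 0, and let φ : ℝ³ → ℝ be twice continuously differentiable with |∇φ(x) − ∇φ(y)| ≤ A·|x − y|^{1−D₁} and ‖∇²φ(x) − ∇²φ(y)‖ ≤ B·|x − y|^{D₂} for all x, y ∈ ℝ³, where A, B ≥ 0. Then for every t ≥ 0 and every x ∈ ℝ³, ‖∇²φ(x)‖ ≤ e^{D₁Λ₀t}·A + e^{−D₂Λ₀t}·B. -/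
open Real

noncomputable section

/-- Interpolation with exponential rates (whole-space version of Lemma 7.1):
under the same Hölder hypotheses on `∇φ` and `∇²φ`, for every `t ≥ 0` and every `x`,
`‖∇²φ(x)‖ ≤ e^{D₁ Λ₀ t} A + e^{-D₂ Λ₀ t} B`. -/
theorem stmt_2 (D₁ D₂ A B Λ₀ : ℝ) (hD₁ : 0 < D₁) (hD₁' : D₁ < 1) (hD₂ : 0 < D₂) (hD₂' : D₂ ≤ 1)
    (hΛ₀ : 0 < Λ₀) (hA : 0 ≤ A) (hB : 0 ≤ B)
    (φ : EuclideanSpace ℝ (Fin 3) → ℝ) (hφ : ContDiff ℝ 2 φ)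
    (hgrad : ∀ x y : EuclideanSpace ℝ (Fin 3),
      ‖fderiv ℝ φ x - fderiv ℝ φ y‖ ≤ A * ‖x - y‖ ^ (1 - D₁))
    (hhess : ∀ x y : EuclideanSpace ℝ (Fin 3),
      ‖fderiv ℝ (fderiv ℝ φ) x - fderiv ℝ (fderiv ℝ φ) y‖ ≤ B * ‖x - y‖ ^ D₂)
    (t : ℝ) (ht : 0 ≤ t) (x : EuclideanSpace ℝ (Fin 3)) :
    ‖fderiv ℝ (fderiv ℝ φ) x‖ ≤ Real.exp (D₁ * Λ₀ * t) * A + Real.exp (-(D₂ * Λ₀ * t)) * B := by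
  have hdiff : Differentiable ℝ (fderiv ℝ φ) :=
    (hφ.fderiv_right (m := 1) (by norm_num)).differentiable (by norm_num)
  set r : ℝ := Real.exp (-(Λ₀ * t)) with hr
  have hr0 : 0 < r := Real.exp_pos _
  have e1 : r ^ (1 - D₁) = r * Real.exp (D₁ * Λ₀ * t) := by
    rw [hr, ← Real.exp_mul, ← Real.exp_add]; congr 1; ring
  have e2 : r ^ D₂ = Real.exp (-(D₂ * Λ₀ * t)) := by
    rw [hr, ← Real.exp_mul]; congr 1; ring
  refine ContinuousLinearMap.opNorm_le_of_unit_norm (by positivity) ?_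
  intro v hv
  have hru : ‖r • v‖ = r := by rw [norm_smul, hv, mul_one, Real.norm_of_nonneg hr0.le]
  have key := (convex_closedBall x r).norm_image_sub_le_of_norm_fderiv_le' (𝕜 := ℝ)
    (f := fderiv ℝ φ) (φ := fderiv ℝ (fderiv ℝ φ) x) (C := B * r ^ D₂) (x := x) (y := x + r • v)
    (fun y _ => hdiff y)
    (fun y hy => (hhess y x).trans (by
      have : ‖y - x‖ ≤ r := by simpa [dist_eq_norm] using hy
      gcongr))
    (Metric.mem_closedBall_self hr0.le) (by simp [hru])
  have h1 := hgrad (x + r • v) x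
  rw [add_sub_cancel_left, hru, e2] at key
  rw [add_sub_cancel_left, hru, e1] at h1
  have h2 := norm_sub_norm_le (fderiv ℝ (fderiv ℝ φ) x (r • v)) (fderiv ℝ φ (x + r • v) - fderiv ℝ φ x)
  rw [map_smul, norm_smul, Real.norm_of_nonneg hr0.le] at h2
  rw [map_smul, norm_sub_rev] at key
  refine le_of_mul_le_mul_left ?_ hr0
  nlinarith
end
end

section
/- For ϱ > 0 define the kernel k_ϱ(v,u) := |v−u|^{−1}·exp(−ϱ|v−u|² − ϱ·(|v|²−|u|²)²/|v−u|²) for u ≠ v in ℝ³. If ϑ > 0, ϱ̃ > 0 and ϱ̃ ≤ ϱ − ϑ/2, then for all u, v ∈ ℝ³ with u ≠ v, k_ϱ(v,u)·e^{ϑ|v|²}/e^{ϑ|u|²} ≤ k_{ϱ̃}(v,u). -/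
open Real

noncomputable section

/-- The Grad-type comparison kernel `k_ϱ(v,u)` of (2.15). -/
def kern (ϱ : ℝ) (v u : EuclideanSpace ℝ (Fin 3)) : ℝ :=
  ‖v - u‖⁻¹ *
    Real.exp (-ϱ * ‖v - u‖ ^ 2 - ϱ * (‖v‖ ^ 2 - ‖u‖ ^ 2) ^ 2 / ‖v - u‖ ^ 2)

/-- Weighted kernel comparison (2.16): if `ϑ > 0`, `ϱ̃ > 0` and
`ϱ̃ ≤ ϱ - ϑ/2`, then for all `u ≠ v`,
`k_ϱ(v,u) e^{ϑ|v|²}/e^{ϑ|u|²} ≤ k_{ϱ̃}(v,u)`. -/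
theorem stmt_4 (ϱ ϱ' ϑ : ℝ) (hϱ : 0 < ϱ) (hϑ : 0 < ϑ) (hϱ' : 0 < ϱ')
    (hle : ϱ' ≤ ϱ - ϑ / 2) (u v : EuclideanSpace ℝ (Fin 3)) (huv : u ≠ v) :
    kern ϱ v u * Real.exp (ϑ * ‖v‖ ^ 2) / Real.exp (ϑ * ‖u‖ ^ 2) ≤ kern ϱ' v u := by
  have ha : 0 < ‖v - u‖ := norm_pos_iff.mpr (sub_ne_zero.mpr huv.symm)
  unfold kern
  rw [mul_assoc, mul_div_assoc, ← Real.exp_add, ← Real.exp_sub]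
  refine mul_le_mul_of_nonneg_left (Real.exp_le_exp.mpr ?_) (inv_nonneg.mpr ha.le)
  generalize ‖v‖ ^ 2 = p
  generalize ‖u‖ ^ 2 = q
  have hb : 0 < ‖v - u‖ ^ 2 := by positivity
  generalize ‖v - u‖ ^ 2 = b at hb
  rw [mul_div_assoc, mul_div_assoc]
  have h1 : 2 * (p - q) ≤ b + (p - q) ^ 2 / b := by
    have h : b + (p - q) ^ 2 / b - 2 * (p - q) = (b - (p - q)) ^ 2 / b := by
      field_simp
      ring
    have : 0 ≤ (b - (p - q)) ^ 2 / b := by positivity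
    linarith
  have h2 : 0 ≤ (p - q) ^ 2 / b := by positivity
  generalize (p - q) ^ 2 / b = e at *
  nlinarith [mul_nonneg (sub_nonneg.mpr hle) (add_nonneg hb.le h2),
    mul_le_mul_of_nonneg_left h1 hϑ.le]
end
end

section
/- For ϱ > 0 define k_ϱ(v,u) := |v−u|^{−1}·exp(−ϱ|v−u|² − ϱ·(|v|²−|u|²)²/|v−u|²) for u ≠ v in ℝ³, and define the hard-sphere kernel K₁(v,w) := π·|v−w|·e^{−(|v|²+|w|²)/4}. Then for every ϱ ∈ (0, 1/16) there exists a constant C > 0 such that for all v ∈ ℝ³ and all u ∈ ℝ³ with u ≠ 0, the gradient in v of the map v ↦ K₁(v, u+v) (with u held fixed) satisfies ‖∇_v [K₁(v, u+v)]‖ ≤ C·k_ϱ(v, u+v) = C·|u|^{−1}·exp(−ϱ|u|² − ϱ·(|v|²−|u+v|²)²/|u|²). -/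
open Real

noncomputable section

/-- The loss part `k₁(v,w) = π |v-w| e^{-(|v|²+|w|²)/4}` of the Grad hard-sphere kernel (1.18). -/
def K1 (v w : EuclideanSpace ℝ (Fin 3)) : ℝ :=
  Real.pi * ‖v - w‖ * Real.exp (-(‖v‖ ^ 2 + ‖w‖ ^ 2) / 4)

/-- Derivative estimate (4.3): for `0 < ϱ < 1/16` there is `C > 0` such that
for all `v` and all `u ≠ 0`,
`‖∇_v [k₁(v, u+v)]‖ ≤ C k_ϱ(v, u+v) = C |u|⁻¹ exp(-ϱ|u|² - ϱ(|v|²-|u+v|²)²/|u|²)`. -/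
theorem stmt_13 (ϱ : ℝ) (hϱ0 : 0 < ϱ) (hϱ : ϱ < 1 / 16) :
    ∃ C : ℝ, 0 < C ∧ ∀ (v u : EuclideanSpace ℝ (Fin 3)), u ≠ 0 →
      ‖fderiv ℝ (fun w => K1 w (u + w)) v‖ ≤ C * kern ϱ v (u + v) ∧
      C * kern ϱ v (u + v) =
        C * (‖u‖⁻¹ *
          Real.exp (-ϱ * ‖u‖ ^ 2 - ϱ * (‖v‖ ^ 2 - ‖u + v‖ ^ 2) ^ 2 / ‖u‖ ^ 2)) := by
  refine ⟨72 * Real.pi, by positivity, fun v u hu => ?_⟩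
  have hsub : ∀ w : EuclideanSpace ℝ (Fin 3), ‖w - (u + w)‖ = ‖u‖ := by
    intro w
    rw [show w - (u + w) = -u by abel, norm_neg]
  have hU : 0 < ‖u‖ := norm_pos_iff.mpr hu
  have hk : kern ϱ v (u + v) = ‖u‖⁻¹ *
      Real.exp (-ϱ * ‖u‖ ^ 2 - ϱ * (‖v‖ ^ 2 - ‖u + v‖ ^ 2) ^ 2 / ‖u‖ ^ 2) := by
    unfold kern
    rw [hsub]
  refine ⟨?_, by rw [hk]⟩
  rw [hk]
  have hfun : (fun w => K1 w (u + w)) =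
      fun w => (Real.pi * ‖u‖) * Real.exp (-(1 / 4) * (‖w‖ ^ 2 + ‖u + w‖ ^ 2)) := by
    funext w
    unfold K1
    rw [hsub]
    congr 2
    ring
  have h1 : HasFDerivAt (fun w : EuclideanSpace ℝ (Fin 3) => ‖w‖ ^ 2)
      (2 • (innerSL ℝ v).comp (ContinuousLinearMap.id ℝ _)) v := (hasFDerivAt_id v).norm_sq
  have h2 : HasFDerivAt (fun w : EuclideanSpace ℝ (Fin 3) => ‖u + w‖ ^ 2)
      (2 • (innerSL ℝ (u + v)).comp (ContinuousLinearMap.id ℝ _)) v :=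
    ((hasFDerivAt_id v).const_add u).norm_sq
  have h3 := (((h1.add h2).const_mul (-(1 / 4))).exp).const_mul (Real.pi * ‖u‖)
  rw [hfun]
  have h4 : fderiv ℝ (fun w : EuclideanSpace ℝ (Fin 3) =>
      (Real.pi * ‖u‖) * Real.exp (-(1 / 4) * (‖w‖ ^ 2 + ‖u + w‖ ^ 2))) v = _ := h3.fderiv
  rw [h4]
  set S := ‖v‖ ^ 2 + ‖u + v‖ ^ 2 with hS
  have hS0 : 0 ≤ S := by positivity
  have hn : ‖(2 • (innerSL ℝ v).comp (ContinuousLinearMap.id ℝ (EuclideanSpace ℝ (Fin 3))) +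
      2 • (innerSL ℝ (u + v)).comp (ContinuousLinearMap.id ℝ (EuclideanSpace ℝ (Fin 3))))‖
      ≤ 2 * ‖v‖ + 2 * ‖u + v‖ := by
    refine (norm_add_le _ _).trans ?_
    rw [ContinuousLinearMap.comp_id, ContinuousLinearMap.comp_id]
    refine add_le_add ((norm_nsmul_le).trans ?_) ((norm_nsmul_le).trans ?_) <;>
      simp only [innerSL_apply_norm] <;> norm_num
  have hpar : ‖u‖ ^ 2 + ‖v + (u + v)‖ ^ 2 = 2 * S := by
    have := parallelogram_law_with_norm ℝ v (u + v)
    rw [hsub] at this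
    rw [hS]; nlinarith
  have hcs : (‖v‖ ^ 2 - ‖u + v‖ ^ 2) ^ 2 / ‖u‖ ^ 2 ≤ ‖v + (u + v)‖ ^ 2 := by
    rw [div_le_iff₀ (by positivity)]
    have e : ‖v‖ ^ 2 - ‖u + v‖ ^ 2 = inner ℝ (v + (u + v)) (v - (u + v)) := by
      generalize u + v = w
      rw [inner_sub_right, inner_add_left, inner_add_left, real_inner_self_eq_norm_sq,
        real_inner_self_eq_norm_sq, real_inner_comm v w]
      ring
    rw [e, ← hsub v, ← mul_pow]
    exact sq_le_sq' (by linarith [neg_abs_le (inner ℝ (v + (u + v)) (v - (u + v))),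
      abs_real_inner_le_norm (v + (u + v)) (v - (u + v))]) (real_inner_le_norm _ _)
  have hE : Real.exp (-(1 / 4) * S) * Real.exp (S / 8) ≤
      Real.exp (-ϱ * ‖u‖ ^ 2 - ϱ * (‖v‖ ^ 2 - ‖u + v‖ ^ 2) ^ 2 / ‖u‖ ^ 2) := by
    rw [← Real.exp_add, Real.exp_le_exp, mul_div_assoc]
    nlinarith [mul_le_mul_of_nonneg_left hcs hϱ0.le]
  have hpoly : S * (1 + S / 2) ≤ 72 * Real.exp (S / 8) := by
    have := Real.quadratic_le_exp_of_nonneg (show 0 ≤ S / 8 by positivity)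
    nlinarith
  have hA : ‖u‖ ^ 2 * ((‖v‖ + ‖u + v‖) / 2) ≤ S * (1 + S / 2) := by
    have a1 : ‖u‖ ^ 2 ≤ 2 * S := by nlinarith [sq_nonneg ‖v + (u + v)‖]
    have a2 : (‖v‖ + ‖u + v‖) / 2 ≤ (1 + S / 2) / 2 := by
      nlinarith [sq_nonneg (‖v‖ - 1), sq_nonneg (‖u + v‖ - 1)]
    calc _ ≤ (2 * S) * ((1 + S / 2) / 2) := by gcongr
      _ = _ := by ring
  rw [norm_smul, norm_smul, norm_smul, Real.norm_of_nonneg (by positivity : 0 ≤ Real.pi * ‖u‖),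
    Real.norm_of_nonneg (Real.exp_pos _).le]
  have hq : ‖(-(1 / 4) : ℝ)‖ = 1 / 4 := by norm_num
  rw [hq]
  set E := Real.exp (-(1 / 4) * S)
  have hE0 : 0 < E := Real.exp_pos _
  calc _ ≤ Real.pi * ‖u‖ * (E * (1 / 4 * (2 * ‖v‖ + 2 * ‖u + v‖))) := by
          gcongr
          exact le_refl E
    _ = Real.pi * ‖u‖⁻¹ * (E * (‖u‖ ^ 2 * ((‖v‖ + ‖u + v‖) / 2))) := by
      field_simp
      ring
    _ ≤ Real.pi * ‖u‖⁻¹ * (E * (72 * Real.exp (S / 8))) := by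
      have := hA.trans hpoly
      exact mul_le_mul_of_nonneg_left (mul_le_mul_of_nonneg_left this hE0.le) (by positivity)
    _ = 72 * Real.pi * (‖u‖⁻¹ * (E * Real.exp (S / 8))) := by ring
    _ ≤ _ := by gcongr
end
end

section
/- For ϱ > 0 define k_ϱ(v,u) := |v−u|^{−1}·exp(−ϱ|v−u|² − ϱ·(|v|²−|u|²)²/|v−u|²) for u ≠ v in ℝ³, and define the hard-sphere kernel K₂(v,w) := π·|v−w|^{−1}·e^{−|v−w|²/8}·e^{−(|v|²−|w|²)²/(8|v−w|²)}. Then for every ϱ ∈ (0, 1/16] there exists a constant C > 0 such that for all v ∈ ℝ³ and all u ∈ ℝ³ with u ≠ 0, the gradient in v of the map v ↦ K₂(v, u+v) (with u held fixed) satisfies ‖∇_v [K₂(v, u+v)]‖ ≤ C·k_ϱ(v, u+v) = C·|u|^{−1}·exp(−ϱ|u|² − ϱ·(|v|²−|u+v|²)²/|u|²). -/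
open Real

noncomputable section

/-- The gain part `k₂(v,w) = π |v-w|⁻¹ e^{-|v-w|²/8} e^{-(|v|²-|w|²)²/(8|v-w|²)}` of the Grad
hard-sphere kernel (1.18). -/
def K2 (v w : EuclideanSpace ℝ (Fin 3)) : ℝ :=
  Real.pi * ‖v - w‖⁻¹ * Real.exp (-‖v - w‖ ^ 2 / 8) *
    Real.exp (-(‖v‖ ^ 2 - ‖w‖ ^ 2) ^ 2 / (8 * ‖v - w‖ ^ 2))

/-- Derivative estimate (4.4): for `0 < ϱ ≤ 1/16` there is `C > 0` such that
for all `v` and all `u ≠ 0`,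
`‖∇_v [k₂(v, u+v)]‖ ≤ C k_ϱ(v, u+v) = C |u|⁻¹ exp(-ϱ|u|² - ϱ(|v|²-|u+v|²)²/|u|²)`. -/
theorem stmt_14 (ϱ : ℝ) (hϱ0 : 0 < ϱ) (hϱ : ϱ ≤ 1 / 16) :
    ∃ C : ℝ, 0 < C ∧ ∀ (v u : EuclideanSpace ℝ (Fin 3)), u ≠ 0 →
      ‖fderiv ℝ (fun w => K2 w (u + w)) v‖ ≤ C * kern ϱ v (u + v) ∧
      C * kern ϱ v (u + v) =
        C * (‖u‖⁻¹ *
          Real.exp (-ϱ * ‖u‖ ^ 2 - ϱ * (‖v‖ ^ 2 - ‖u + v‖ ^ 2) ^ 2 / ‖u‖ ^ 2)) := by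
  refine ⟨Real.pi, Real.pi_pos, fun v u hu => ?_⟩
  have hn : ∀ w : EuclideanSpace ℝ (Fin 3), ‖w - (u + w)‖ = ‖u‖ := by
    intro w
    rw [show w - (u + w) = -u by abel, norm_neg]
  have hk : Real.pi * kern ϱ v (u + v) =
        Real.pi * (‖u‖⁻¹ *
          Real.exp (-ϱ * ‖u‖ ^ 2 - ϱ * (‖v‖ ^ 2 - ‖u + v‖ ^ 2) ^ 2 / ‖u‖ ^ 2)) := by
    simp only [kern, hn]
  refine ⟨?_, hk⟩
  rw [hk]
  have hr : 0 < ‖u‖ := norm_pos_iff.mpr hu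
  have hs : ∀ w : EuclideanSpace ℝ (Fin 3),
      ‖w‖ ^ 2 - ‖u + w‖ ^ 2 = -(2 * inner ℝ u w + ‖u‖ ^ 2) := by
    intro w
    rw [norm_add_sq_real]; ring
  set r := ‖u‖ with hrdef
  have hf : (fun w => K2 w (u + w)) = fun w =>
      (Real.pi * r⁻¹ * Real.exp (-r ^ 2 / 8)) *
        Real.exp (-(1 / (8 * r ^ 2)) * (2 * innerSL ℝ u w + r ^ 2) ^ 2) := by
    funext w
    simp only [K2, hn, hs, innerSL_apply_apply]
    congr 2
    ring
  have hd : HasFDerivAt (fun w => K2 w (u + w))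
      ((Real.pi * r⁻¹ * Real.exp (-r ^ 2 / 8) *
        (Real.exp (-(1 / (8 * r ^ 2)) * (2 * inner ℝ u v + r ^ 2) ^ 2) *
          (-(1 / (8 * r ^ 2)) * (2 * (2 * inner ℝ u v + r ^ 2) * 2)))) • innerSL ℝ u) v := by
    rw [hf]
    have h1 : HasFDerivAt (fun w => innerSL ℝ u w) (innerSL ℝ u) v :=
      (innerSL ℝ u).hasFDerivAt
    have h2 : HasDerivAt (fun x : ℝ => (Real.pi * r⁻¹ * Real.exp (-r ^ 2 / 8)) *
        Real.exp (-(1 / (8 * r ^ 2)) * (2 * x + r ^ 2) ^ 2))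
        (Real.pi * r⁻¹ * Real.exp (-r ^ 2 / 8) *
        (Real.exp (-(1 / (8 * r ^ 2)) * (2 * inner ℝ u v + r ^ 2) ^ 2) *
          (-(1 / (8 * r ^ 2)) * (2 * (2 * inner ℝ u v + r ^ 2) * 2)))) (innerSL ℝ u v) := by
      have h3 := ((((((hasDerivAt_id (innerSL ℝ u v)).const_mul 2).add_const (r ^ 2)).pow 2).const_mul
        (-(1 / (8 * r ^ 2)))).exp).const_mul (Real.pi * r⁻¹ * Real.exp (-r ^ 2 / 8))
      refine h3.congr_deriv ?_
      simp [innerSL_apply_apply]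
    exact h2.comp_hasFDerivAt v h1
  rw [hd.fderiv, norm_smul, innerSL_apply_norm, hs, ← hrdef]
  set s := 2 * inner ℝ u v + r ^ 2 with hsdef
  rw [Real.norm_eq_abs, abs_mul, abs_mul (Real.exp _), abs_of_pos (by positivity :
    0 < Real.pi * r⁻¹ * Real.exp (-r ^ 2 / 8)), Real.abs_exp]
  have ha : |-(1 / (8 * r ^ 2)) * (2 * s * 2)| * r = (|s| / r) / 2 := by
    rw [abs_mul, abs_neg, abs_of_pos (by positivity : 0 < 1 / (8 * r ^ 2)), abs_mul, abs_mul]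
    norm_num
    field_simp
    norm_num
  set t := |s| / r with ht
  have ht2 : t ^ 2 = s ^ 2 / r ^ 2 := by rw [ht, div_pow, sq_abs]
  have e1 : -(1 / (8 * r ^ 2)) * s ^ 2 = -t ^ 2 / 8 := by
    rw [ht2]; field_simp
  have e2 : -ϱ * r ^ 2 - ϱ * (-s) ^ 2 / r ^ 2 = -ϱ * r ^ 2 - ϱ * t ^ 2 := by
    rw [ht2]; ring
  rw [e1, e2]
  have hb : t / 2 ≤ Real.exp (t ^ 2 / 16) := by
    have := Real.add_one_le_exp (t ^ 2 / 16)
    nlinarith [sq_nonneg (t / 4 - 1)]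
  calc _ = Real.pi * (r⁻¹ * (Real.exp (-r ^ 2 / 8) * Real.exp (-t ^ 2 / 8) * (t / 2))) := by
        rw [← ha]; ring
    _ ≤ Real.pi * (r⁻¹ * (Real.exp (-r ^ 2 / 8) * Real.exp (-t ^ 2 / 8) *
          Real.exp (t ^ 2 / 16))) := by gcongr
    _ ≤ _ := by
        rw [← Real.exp_add, ← Real.exp_add]
        gcongr
        nlinarith [mul_nonneg (sub_nonneg.mpr hϱ) (sq_nonneg r),
          mul_nonneg (sub_nonneg.mpr hϱ) (sq_nonneg t), sq_nonneg r]
end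
end
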